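/- Triviality of the first compactly supported de Rham cohomology of ℝ^m for m ≥ 2, stated for 1-forms on ℝ^m: let m ≥ 2 and let ω : ℝ^m → L(ℝ^m, ℝ) be smooth with compact support and closed, i.e. for every x ∈ ℝ^m the derivative Dω(x) is symmetric in the sense that (Dω(x) v)(w) = (Dω(x) w)(v) for all v, w ∈ ℝ^m. Then there exists a smooth compactly supported function g : ℝ^m → ℝ with Dg(x) = ω(x) for all x ∈ ℝ^m. -/

import Mathlib

/-- In a real normed space of dimension `> 1`, the complement of a closed ball centred at the
origin is preconnected. -/
theorem isPreconnected_compl_closedBall_zero {E : Type*} [NormedAddCommGroup E] [NormedSpace ℝ E]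
    (h : 1 < Module.rank ℝ E) {r : ℝ} (hr : 0 ≤ r) :
    IsPreconnected (Metric.closedBall (0 : E) r)ᶜ := by
  have himage : (fun x : E => (1 + r * ‖x‖⁻¹) • x) '' {0}ᶜ = (Metric.closedBall (0 : E) r)ᶜ := by
    ext y
    simp only [Set.mem_image, Set.mem_compl_iff, Set.mem_singleton_iff, mem_closedBall_zero_iff,
      not_le]
    constructor
    · rintro ⟨x, hx, rfl⟩
      have hx' : 0 < ‖x‖ := norm_pos_iff.mpr hx
      rw [norm_smul, Real.norm_of_nonneg (by positivity), add_mul, mul_assoc,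
        inv_mul_cancel₀ hx'.ne']
      linarith
    · intro hy
      have hy' : 0 < ‖y‖ := hr.trans_lt hy
      have hc : 0 < 1 - r * ‖y‖⁻¹ := by
        rw [sub_pos, ← div_eq_mul_inv, div_lt_one hy']
        exact hy
      refine ⟨(1 - r * ‖y‖⁻¹) • y, smul_ne_zero hc.ne' (norm_pos_iff.mp hy'), ?_⟩
      have hsub : ‖y‖ - r ≠ 0 := (sub_pos.mpr hy).ne'
      have hone : (1 + r * ‖(1 - r * ‖y‖⁻¹) • y‖⁻¹) * (1 - r * ‖y‖⁻¹) = 1 := by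
        have hnorm : ‖(1 - r * ‖y‖⁻¹) • y‖ = ‖y‖ - r := by
          rw [norm_smul, Real.norm_of_nonneg hc.le]
          field_simp
        rw [hnorm]
        field_simp
        ring
      rw [smul_smul, hone, one_smul]
  rw [← himage]
  refine (isConnected_compl_singleton_of_one_lt_rank h (0 : E)).isPreconnected.image _ ?_
  have hinv : ContinuousOn (fun x : E => ‖x‖⁻¹) {0}ᶜ :=
    continuous_norm.continuousOn.inv₀ fun x hx => norm_ne_zero_iff.mpr hx
  fun_prop

/-- Triviality of the first compactly supported de Rham cohomology of `ℝ^m`, `m ≥ 2`: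
every smooth compactly supported closed 1-form `ω` on `ℝ^m` is the differential of a
smooth compactly supported function `g`. -/
theorem stmt_12 (m : ℕ) (hm : 2 ≤ m)
    (ω : EuclideanSpace ℝ (Fin m) → (EuclideanSpace ℝ (Fin m) →L[ℝ] ℝ))
    (hω_smooth : ContDiff ℝ (⊤ : ℕ∞) ω) (hω_supp : HasCompactSupport ω)
    (hω_closed : ∀ x : EuclideanSpace ℝ (Fin m), ∀ v w : EuclideanSpace ℝ (Fin m),
      (fderiv ℝ ω x v) w = (fderiv ℝ ω x w) v) :
    ∃ g : EuclideanSpace ℝ (Fin m) → ℝ, ContDiff ℝ (⊤ : ℕ∞) g ∧ HasCompactSupport g ∧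
      ∀ x, HasFDerivAt g (ω x) x := by
  obtain ⟨f, hf⟩ : ∃ f : EuclideanSpace ℝ (Fin m) → ℝ, ∀ x, HasFDerivAt f (ω x) x := by
    simpa using convex_univ.exists_forall_hasFDerivAt_of_fderiv_symmetric isOpen_univ
      (hω_smooth.differentiable (by simp)).differentiableOn fun x _ => hω_closed x
  obtain ⟨r, hr, hball⟩ := hω_supp.isCompact.isBounded.subset_closedBall_lt 0 0
  have hrank : 1 < Module.rank ℝ (EuclideanSpace ℝ (Fin m)) := by
    rw [← Module.finrank_eq_rank, finrank_euclideanSpace_fin]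
    exact_mod_cast hm
  obtain ⟨c, hc⟩ := Metric.isClosed_closedBall.isOpen_compl.exists_is_const_of_fderiv_eq_zero
    (isPreconnected_compl_closedBall_zero hrank hr.le)
    (fun x _ => (hf x).differentiableAt.differentiableWithinAt)
    (fun x hx => (hf x).fderiv.trans (image_eq_zero_of_notMem_tsupport fun h => hx (hball h)))
  have hg : ∀ x, HasFDerivAt (fun y => f y - c) (ω x) x := fun x => (hf x).sub_const c
  refine ⟨fun y => f y - c, ?_, ?_, hg⟩
  · refine contDiff_infty_iff_fderiv.mpr ⟨fun x => (hg x).differentiableAt, ?_⟩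
    rwa [funext fun x => (hg x).fderiv]
  · exact HasCompactSupport.intro (isCompact_closedBall 0 r) fun x hx => sub_eq_zero.mpr (hc x hx)
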